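/- arXiv:2103.14041 — 3 statements merged into one kernel-verified Lean document; each statement's English description precedes it below -/
import Mathlib

section
/- Let Q : Fin c → Matrix (Fin n) (Fin n) ℂ be a family of matrices and f : Fin c → Fin c → Fin c → ℂ structure constants satisfying, for all α, β, the commutation relations Q β * Q α − Q α * Q β = Σ_γ f γ β α • Q γ. Then for every α, the commutator of Σ_β (Q β ⊗ₖ Q β) with (Q α ⊗ₖ I + I ⊗ₖ Q α) equals Σ_β Σ_γ f γ β α • (Q γ ⊗ₖ Q β + Q β ⊗ₖ Q γ), where ⊗ₖ denotes the Kronecker product and I the n×n identity matrix. -/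
open Matrix
open scoped Kronecker

/-- The commutator of `A ⊗ B` with `C ⊗ I + I ⊗ C`: the global charge `C` acts as a derivation
on the two tensor factors. -/
theorem Matrix.kronecker_commutator_kronecker_one_add_one_kronecker
    {R m : Type*} [CommRing R] [Fintype m] [DecidableEq m] (A B C : Matrix m m R) :
    (A ⊗ₖ B) * (C ⊗ₖ (1 : Matrix m m R) + (1 : Matrix m m R) ⊗ₖ C)
      - (C ⊗ₖ (1 : Matrix m m R) + (1 : Matrix m m R) ⊗ₖ C) * (A ⊗ₖ B)
      = (A * C - C * A) ⊗ₖ B + A ⊗ₖ (B * C - C * B) := by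
  have hl : (A * C - C * A) ⊗ₖ B = (A * C) ⊗ₖ B - (C * A) ⊗ₖ B := by
    ext
    simp [sub_mul]
  have hr : A ⊗ₖ (B * C - C * B) = A ⊗ₖ (B * C) - A ⊗ₖ (C * B) := by
    ext
    simp [mul_sub]
  simp only [hl, hr, mul_add, add_mul, ← mul_kronecker_mul, mul_one, one_mul]
  abel

/-- If the family `Q` closes under commutation with structure constants `f`, then
the commutator of `H = Σ_β Q β ⊗ Q β` with the global charge
`Q α ⊗ I + I ⊗ Q α` equals `Σ_β Σ_γ f γ β α • (Q γ ⊗ Q β + Q β ⊗ Q γ)`. -/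
theorem commutator_H_global_charge
    (n c : ℕ)
    (Q : Fin c → Matrix (Fin n) (Fin n) ℂ)
    (f : Fin c → Fin c → Fin c → ℂ)
    (hf : ∀ α β, Q β * Q α - Q α * Q β = ∑ γ, f γ β α • Q γ)
    (α : Fin c) :
    (∑ β, Q β ⊗ₖ Q β) * (Q α ⊗ₖ (1 : Matrix (Fin n) (Fin n) ℂ)
        + (1 : Matrix (Fin n) (Fin n) ℂ) ⊗ₖ Q α)
      - (Q α ⊗ₖ (1 : Matrix (Fin n) (Fin n) ℂ)
        + (1 : Matrix (Fin n) (Fin n) ℂ) ⊗ₖ Q α) * (∑ β, Q β ⊗ₖ Q β)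
      = ∑ β, ∑ γ, f γ β α • (Q γ ⊗ₖ Q β + Q β ⊗ₖ Q γ) := by
  have hl (β : Fin c) : (∑ γ, f γ β α • Q γ) ⊗ₖ Q β = ∑ γ, f γ β α • (Q γ ⊗ₖ Q β) := by
    ext
    simp [Matrix.sum_apply, Finset.sum_mul, mul_assoc]
  have hr (β : Fin c) : Q β ⊗ₖ (∑ γ, f γ β α • Q γ) = ∑ γ, f γ β α • (Q β ⊗ₖ Q γ) := by
    ext
    simp [Matrix.sum_apply, Finset.mul_sum, mul_left_comm]
  rw [Finset.sum_mul, Finset.mul_sum, ← Finset.sum_sub_distrib]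
  refine Finset.sum_congr rfl fun β _ => ?_
  rw [kronecker_commutator_kronecker_one_add_one_kronecker, hf, hl, hr]
  simp only [smul_add, Finset.sum_add_distrib]
end

section
/- Let Q : Fin c → Matrix (Fin n) (Fin n) ℂ be a family of matrices and f : Fin c → Fin c → Fin c → ℂ structure constants satisfying, for all α, β, the commutation relations Q β * Q α − Q α * Q β = Σ_γ f γ β α • Q γ, and suppose f has the antisymmetry property f γ α β = − f α γ β for all α, β, γ (i.e. f_{αβ}^γ = −f_{γβ}^α, antisymmetry under exchange of the upper index with the first lower index). Then for every α, the matrix H = Σ_β (Q β ⊗ₖ Q β) commutes with Q α ⊗ₖ I + I ⊗ₖ Q α, where ⊗ₖ denotes the Kronecker product and I the n×n identity matrix. -/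
open Matrix
open scoped Kronecker

theorem Matrix.sub_kronecker {R l m n p : Type*} [NonUnitalNonAssocRing R]
    (A B : Matrix l m R) (C : Matrix n p R) :
    (A - B) ⊗ₖ C = A ⊗ₖ C - B ⊗ₖ C := by
  ext i j
  exact sub_mul _ _ _

theorem Matrix.kronecker_sub {R l m n p : Type*} [NonUnitalNonAssocRing R]
    (A : Matrix l m R) (B C : Matrix n p R) :
    A ⊗ₖ (B - C) = A ⊗ₖ B - A ⊗ₖ C := by
  ext i j
  exact mul_sub _ _ _

/-- Paper's Proposition 2: if the structure constants are antisymmetric under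
exchange of the upper index with the first lower index, then the two-body
Hamiltonian `H = Σ_β Q β ⊗ Q β` commutes with each global charge
`Q α ⊗ I + I ⊗ Q α`. -/
theorem H_commutes_with_global_charge
    (n c : ℕ)
    (Q : Fin c → Matrix (Fin n) (Fin n) ℂ)
    (f : Fin c → Fin c → Fin c → ℂ)
    (hf : ∀ α β, Q β * Q α - Q α * Q β = ∑ γ, f γ β α • Q γ)
    (hanti : ∀ α β γ, f γ α β = - f α γ β)
    (α : Fin c) :
    (∑ β, Q β ⊗ₖ Q β) * (Q α ⊗ₖ (1 : Matrix (Fin n) (Fin n) ℂ)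
        + (1 : Matrix (Fin n) (Fin n) ℂ) ⊗ₖ Q α)
      = (Q α ⊗ₖ (1 : Matrix (Fin n) (Fin n) ℂ)
        + (1 : Matrix (Fin n) (Fin n) ℂ) ⊗ₖ Q α) * (∑ β, Q β ⊗ₖ Q β) := by
  have commutator_kronecker : ∑ β, (Q β * Q α - Q α * Q β) ⊗ₖ Q β
      = -∑ β, Q β ⊗ₖ (Q β * Q α - Q α * Q β) := by
    ext i j
    simp only [hf, Matrix.sum_apply, Matrix.neg_apply, kroneckerMap_apply, Matrix.smul_apply,
      smul_eq_mul, Finset.sum_mul, Finset.mul_sum, ← Finset.sum_neg_distrib]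
    rw [Finset.sum_comm]
    refine Finset.sum_congr rfl fun β _ => Finset.sum_congr rfl fun γ _ => ?_
    rw [hanti γ α β]
    ring
  rw [← sub_eq_zero, Finset.sum_mul, Finset.mul_sum, ← Finset.sum_sub_distrib]
  calc
    _ = ∑ β, (Q β * Q α - Q α * Q β) ⊗ₖ Q β
        + ∑ β, Q β ⊗ₖ (Q β * Q α - Q α * Q β) := by
      rw [← Finset.sum_add_distrib]
      refine Finset.sum_congr rfl fun β _ => ?_
      simp only [mul_add, add_mul, ← mul_kronecker_mul, mul_one, one_mul, sub_kronecker,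
        kronecker_sub]
      abel
    _ = 0 := by rw [commutator_kronecker, neg_add_cancel]
end

section
/- Let σ_x, σ_y, σ_z be the Pauli matrices and define the ladder operators σ_{±z} = (σ_x ± i σ_y)/2, σ_{±x} = (σ_y ± i σ_z)/2, σ_{±y} = (σ_z ± i σ_x)/2. For complex hopping frequencies J_z, J_x, J_y, set H = Σ_{β ∈ {z,x,y}} J_β (σ_{+β} ⊗ₖ σ_{−β} + σ_{−β} ⊗ₖ σ_{+β}). Then H commutes with all three global charges σ_α^tot = σ_α ⊗ₖ I + I ⊗ₖ σ_α (α ∈ {x,y,z}) if and only if J_x = J_y = J_z. -/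
open Matrix Complex
open scoped Kronecker

noncomputable def σx : Matrix (Fin 2) (Fin 2) ℂ := !![0, 1; 1, 0]
noncomputable def σy : Matrix (Fin 2) (Fin 2) ℂ := !![0, -I; I, 0]
noncomputable def σz : Matrix (Fin 2) (Fin 2) ℂ := !![1, 0; 0, -1]

/-- Ladder operators raising/lowering σz, σx, σy respectively. -/
noncomputable def σpz : Matrix (Fin 2) (Fin 2) ℂ := (1/2 : ℂ) • (σx + I • σy)
noncomputable def σmz : Matrix (Fin 2) (Fin 2) ℂ := (1/2 : ℂ) • (σx - I • σy)
noncomputable def σpx : Matrix (Fin 2) (Fin 2) ℂ := (1/2 : ℂ) • (σy + I • σz)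
noncomputable def σmx : Matrix (Fin 2) (Fin 2) ℂ := (1/2 : ℂ) • (σy - I • σz)
noncomputable def σpy : Matrix (Fin 2) (Fin 2) ℂ := (1/2 : ℂ) • (σz + I • σx)
noncomputable def σmy : Matrix (Fin 2) (Fin 2) ℂ := (1/2 : ℂ) • (σz - I • σx)

/-- The hopping Hamiltonian built from the ladder operators with hopping
frequencies `Jz, Jx, Jy`. -/
noncomputable def Hhop (Jz Jx Jy : ℂ) : Matrix (Fin 2 × Fin 2) (Fin 2 × Fin 2) ℂ :=
  Jz • (σpz ⊗ₖ σmz + σmz ⊗ₖ σpz)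
    + Jx • (σpx ⊗ₖ σmx + σmx ⊗ₖ σpx)
    + Jy • (σpy ⊗ₖ σmy + σmy ⊗ₖ σpy)

/-- The hopping Hamiltonian in the form of an anisotropic Heisenberg exchange coupling. -/
lemma Hhop_eq_exchange (Jz Jx Jy : ℂ) :
    Hhop Jz Jx Jy = ((Jz + Jy) / 2) • (σx ⊗ₖ σx) + ((Jz + Jx) / 2) • (σy ⊗ₖ σy)
      + ((Jx + Jy) / 2) • (σz ⊗ₖ σz) := by
  have h2 : I ^ 2 = -1 := I_sq
  ext ⟨i, j⟩ ⟨k, l⟩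
  fin_cases i <;> fin_cases j <;> fin_cases k <;> fin_cases l <;>
    simp [Hhop, σpz, σmz, σpx, σmx, σpy, σmy, σx, σy, σz] <;> grind

/-- The isotropic exchange coupling conserves every global charge. -/
lemma isotropic_exchange_commute (σ : Matrix (Fin 2) (Fin 2) ℂ) :
    Commute (σx ⊗ₖ σx + σy ⊗ₖ σy + σz ⊗ₖ σz)
      (σ ⊗ₖ (1 : Matrix (Fin 2) (Fin 2) ℂ) + (1 : Matrix (Fin 2) (Fin 2) ℂ) ⊗ₖ σ) := by
  ext ⟨i, j⟩ ⟨k, l⟩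
  fin_cases i <;> fin_cases j <;> fin_cases k <;> fin_cases l <;>
    simp [Matrix.mul_apply, Fintype.sum_prod_type, σx, σy, σz] <;> ring

/-- The hopping Hamiltonian commutes with all three global charges iff the
hopping frequencies are all equal. -/
theorem hop_conserves_iff_equal_frequencies (Jz Jx Jy : ℂ) :
    (∀ σ ∈ ({σx, σy, σz} : Set (Matrix (Fin 2) (Fin 2) ℂ)),
        Hhop Jz Jx Jy
            * (σ ⊗ₖ (1 : Matrix (Fin 2) (Fin 2) ℂ) + (1 : Matrix (Fin 2) (Fin 2) ℂ) ⊗ₖ σ)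
          = (σ ⊗ₖ (1 : Matrix (Fin 2) (Fin 2) ℂ) + (1 : Matrix (Fin 2) (Fin 2) ℂ) ⊗ₖ σ)
            * Hhop Jz Jx Jy)
      ↔ (Jx = Jy ∧ Jy = Jz) := by
  simp only [Hhop_eq_exchange]
  constructor
  · intro h
    have hz := congrFun₂ (h σz (by simp)) (0, 0) (1, 1)
    have hx := congrFun₂ (h σx (by simp)) (0, 0) (0, 1)
    simp [Matrix.mul_apply, Fintype.sum_prod_type, σx, σy, σz] at hz hx
    grind
  · rintro ⟨rfl, rfl⟩ σ -
    simp only [← smul_add]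
    exact (isotropic_exchange_commute σ).smul_left _
end
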